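/- arXiv:2111.02484 — 2 statements merged into one kernel-verified Lean document; each statement's English description precedes it below -/
import Mathlib

section
/- Let U¹, U² ∈ ℝ, σ > 0 and τ_δ ∈ ℝ. If Û¹ and Û² are independent Gaussian random variables with Û¹ ∼ N(U¹, σ²) and Û² ∼ N(U², σ²), then the corrected swap-rate estimator r̂ = exp(τ_δ (Û¹ − Û² − σ² τ_δ)) is unbiased for the true rate: E[exp(τ_δ (Û¹ − Û² − σ² τ_δ))] = exp(τ_δ (U¹ − U²)). -/
open MeasureTheory ProbabilityTheory

/-- If `Û¹ ∼ N(U¹, σ²)` and `Û² ∼ N(U², σ²)` are independent, then the corrected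
swap-rate estimator `r̂ = exp(τ_δ (Û¹ − Û² − σ² τ_δ))` is unbiased:
`E[exp(τ_δ (Û¹ − Û² − σ² τ_δ))] = exp(τ_δ (U¹ − U²))`. -/
theorem corrected_swap_rate_estimator_unbiased
    {Ω : Type*} [MeasureSpace Ω] [IsProbabilityMeasure (volume : Measure Ω)]
    (U₁ U₂ σ τδ : ℝ) (hσ : 0 < σ)
    (X₁ X₂ : Ω → ℝ) (hm₁ : Measurable X₁) (hm₂ : Measurable X₂)
    (h₁ : Measure.map X₁ volume = gaussianReal U₁ (Real.toNNReal (σ ^ 2)))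
    (h₂ : Measure.map X₂ volume = gaussianReal U₂ (Real.toNNReal (σ ^ 2)))
    (hind : IndepFun X₁ X₂ volume) :
    ∫ ω, Real.exp (τδ * (X₁ ω - X₂ ω - σ ^ 2 * τδ))
      = Real.exp (τδ * (U₁ - U₂)) := by
  have hmul : ∫ ω, Real.exp (τδ * X₁ ω) * Real.exp (-τδ * X₂ ω)
      = mgf X₁ volume τδ * mgf X₂ volume (-τδ) :=
    (hind.exp_mul τδ (-τδ)).integral_fun_mul_eq_mul_integral
      (by fun_prop) (by fun_prop)
  calc ∫ ω, Real.exp (τδ * (X₁ ω - X₂ ω - σ ^ 2 * τδ))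
      = ∫ ω, Real.exp (-(σ ^ 2 * τδ ^ 2)) *
          (Real.exp (τδ * X₁ ω) * Real.exp (-τδ * X₂ ω)) := by
        congr with ω
        rw [← Real.exp_add, ← Real.exp_add]
        ring_nf
    _ = Real.exp (τδ * (U₁ - U₂)) := by
        rw [integral_const_mul, hmul, mgf_gaussianReal h₁, mgf_gaussianReal h₂,
          Real.coe_toNNReal _ (sq_nonneg σ), ← Real.exp_add, ← Real.exp_add]
        ring_nf
end

section
/- Let U : ℝ^p → ℝ, θ¹, θ² ∈ ℝ^p, τ_δ ∈ ℝ, σ₁, σ₂ > 0, and a₁, a₂ > 0 with a₁ + a₂ = 1. Let ξ¹ and ξ² be independent standard Gaussian random variables and define the two energy estimators for each particle by Û_j(θⁱ) = U(θⁱ) + σ_j ξⁱ for j ∈ {1, 2} and i ∈ {1, 2} (so Û_j(θⁱ) ∼ N(U(θⁱ), σ_j²)). Then the multi-variance corrected swap-rate estimator r̂ = exp(τ_δ ( a₁(Û₁(θ¹) − Û₁(θ²)) + a₂(Û₂(θ¹) − Û₂(θ²)) − (a₁ σ₁ + a₂ σ₂)² τ_δ )) is unbiased for the true swapping rate: E[r̂]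 = exp(τ_δ (U(θ¹) − U(θ²))). -/
open MeasureTheory ProbabilityTheory

/-- Multi-variance corrected swap-rate estimator is unbiased.  With independent
standard Gaussians `ξ¹, ξ²` and energy estimators `Û_j(θⁱ) = U(θⁱ) + σ_j ξⁱ`
(so `Û_j(θⁱ) ∼ N(U(θⁱ), σ_j²)`), the estimator
`r̂ = exp(τ_δ (a₁(Û₁(θ¹) − Û₁(θ²)) + a₂(Û₂(θ¹) − Û₂(θ²)) − (a₁σ₁ + a₂σ₂)² τ_δ))`
satisfies `E[r̂] = exp(τ_δ (U(θ¹) − U(θ²)))`. -/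
theorem multivariance_swap_rate_estimator_unbiased
    {Ω : Type*} [MeasureSpace Ω] [IsProbabilityMeasure (volume : Measure Ω)]
    (p : ℕ) (U : (Fin p → ℝ) → ℝ) (θ₁ θ₂ : Fin p → ℝ)
    (τδ σ₁ σ₂ a₁ a₂ : ℝ) (hσ₁ : 0 < σ₁) (hσ₂ : 0 < σ₂)
    (ha₁ : 0 < a₁) (ha₂ : 0 < a₂) (ha : a₁ + a₂ = 1)
    (ξ₁ ξ₂ : Ω → ℝ) (hm₁ : Measurable ξ₁) (hm₂ : Measurable ξ₂)
    (h₁ : Measure.map ξ₁ volume = gaussianReal 0 1)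
    (h₂ : Measure.map ξ₂ volume = gaussianReal 0 1)
    (hind : IndepFun ξ₁ ξ₂ volume) :
    ∫ ω, Real.exp (τδ *
        (a₁ * ((U θ₁ + σ₁ * ξ₁ ω) - (U θ₂ + σ₁ * ξ₂ ω))
          + a₂ * ((U θ₁ + σ₂ * ξ₁ ω) - (U θ₂ + σ₂ * ξ₂ ω))
          - (a₁ * σ₁ + a₂ * σ₂) ^ 2 * τδ))
      = Real.exp (τδ * (U θ₁ - U θ₂)) := by
  have hmgf : mgf (ξ₁ + -ξ₂) volume (τδ * (a₁ * σ₁ + a₂ * σ₂))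
      = Real.exp ((τδ * (a₁ * σ₁ + a₂ * σ₂)) ^ 2) := by
    have hind' : IndepFun ξ₁ (-ξ₂) volume := hind.comp measurable_id measurable_neg
    rw [hind'.mgf_add' hm₁.aestronglyMeasurable hm₂.neg.aestronglyMeasurable, mgf_neg,
      mgf_gaussianReal h₁, mgf_gaussianReal h₂, ← Real.exp_add]
    congr 1
    push_cast
    ring
  have hexp : ∀ ω, Real.exp (τδ *
        (a₁ * ((U θ₁ + σ₁ * ξ₁ ω) - (U θ₂ + σ₁ * ξ₂ ω))
          + a₂ * ((U θ₁ + σ₂ * ξ₁ ω) - (U θ₂ + σ₂ * ξ₂ ω))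
          - (a₁ * σ₁ + a₂ * σ₂) ^ 2 * τδ))
      = Real.exp (τδ * (U θ₁ - U θ₂) - (τδ * (a₁ * σ₁ + a₂ * σ₂)) ^ 2)
        * Real.exp (τδ * (a₁ * σ₁ + a₂ * σ₂) * (ξ₁ + -ξ₂) ω) := by
    intro ω
    rw [← Real.exp_add, Pi.add_apply, Pi.neg_apply]
    congr 1
    linear_combination τδ * (U θ₁ - U θ₂) * ha
  simp_rw [hexp]
  rw [integral_const_mul]
  change _ * mgf (ξ₁ + -ξ₂) volume (τδ * (a₁ * σ₁ + a₂ * σ₂)) = _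
  rw [hmgf, ← Real.exp_add, sub_add_cancel]
end
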